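/- Let Ω be a standard Borel probability space, U : Ω → 𝒰 ⊂ ℝ^m measurable, 𝒢 a sub-σ-field, and κ_ω a regular conditional distribution of U given 𝒢 (e.g. obtained from the conditional-expectation kernel). Then: (i) there exists a 𝒢-measurable map g : Ω → Δ such that for almost every ω, ∫ log⟨g(ω), u⟩ dκ_ω(u) = sup_{b ∈ Δ} ∫ log⟨b, u⟩ dκ_ω(u); and (ii) E[ sup_{b ∈ Δ} ∫ log⟨b, u⟩ dκ_ω(u) ] = sup { E(log⟨h, U⟩) : h : Ω → Δ is 𝒢-measurable }. (Paper's Lemma 3(a).) -/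

import Mathlib

open MeasureTheory Filter
open scoped BigOperators ENNReal Topology

/-- Inner product of two vectors in `ℝ^m`. -/
noncomputable def ip {m : ℕ} (b x : Fin m → ℝ) : ℝ := ∑ i, b i * x i

/-- The closed portfolio simplex. -/
def simplex (m : ℕ) : Set (Fin m → ℝ) := {b | (∀ i, 0 ≤ b i) ∧ ∑ i, b i = 1}

/-- The uniform reference portfolio `b̂ = (1/m, …, 1/m)`. -/
noncomputable def bhat (m : ℕ) : Fin m → ℝ := fun _ => (m : ℝ)⁻¹

/-- The set `𝒰` of normalized return vectors. -/
def Uset (m : ℕ) : Set (Fin m → ℝ) := {u | (∀ i, 0 < u i) ∧ ip (bhat m) u = 1}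

/-- `nlog m r` is the nonnegative extended-real value `log m − log r`, set to `∞` for `r ≤ 0`. -/
noncomputable def nlog (m : ℕ) (r : ℝ) : ℝ≥0∞ :=
  if r ≤ 0 then ⊤ else ENNReal.ofReal (Real.log m - Real.log r)

/-- `∫ log⟨b, u⟩ dQ(u) ∈ [−∞, log m]` for a measure `Q` supported on `𝒰`. -/
noncomputable def elogQ {m : ℕ} (Q : Measure (Fin m → ℝ)) (b : Fin m → ℝ) : EReal :=
  (Real.log m : EReal) - ((∫⁻ u, nlog m (ip b u) ∂Q : ℝ≥0∞) : EReal)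

/-- `E(log⟨h(ω), U(ω)⟩) ∈ [−∞, log m]` for a random portfolio `h`. -/
noncomputable def elogE {Ω : Type*} [MeasurableSpace Ω] (P : Measure Ω) (m : ℕ)
    (h U : Ω → (Fin m → ℝ)) : EReal :=
  (Real.log m : EReal) - ((∫⁻ ω, nlog m (ip (h ω) (U ω)) ∂P : ℝ≥0∞) : EReal)

/-- `κ` is a regular conditional distribution of `U` given the sub-σ-field `G` under `P`. -/
def IsRCD {Ω : Type*} [MeasurableSpace Ω] {m : ℕ} (P : Measure Ω) (G : MeasurableSpace Ω)
    (U : Ω → (Fin m → ℝ)) (κ : Ω → Measure (Fin m → ℝ)) : Prop :=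
  (∀ ω, IsProbabilityMeasure (κ ω)) ∧
  (∀ A : Set (Fin m → ℝ), MeasurableSet A → Measurable[G] (fun ω => κ ω A)) ∧
  (∀ A : Set (Fin m → ℝ), MeasurableSet A → ∀ S : Set Ω, MeasurableSet[G] S →
      ∫⁻ ω in S, κ ω A ∂P = P (S ∩ U ⁻¹' A))

open ProbabilityTheory

/-- A sequence of measurable maps with values in a countable part of a compact metric space has a
measurable selection of subsequential limits. -/
theorem exists_measurable_subseq_limit {α X : Type*} [MeasurableSpace α] [MetricSpace X]
    [CompactSpace X] [Nonempty X] [MeasurableSpace X] [BorelSpace X] (d : ℕ → X)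
    (N : ℕ → α → ℕ) (hN : ∀ n, Measurable (N n)) :
    ∃ g : α → X, Measurable g ∧ ∀ a, ∃ φ : ℕ → ℕ, Tendsto φ atTop atTop ∧
      Tendsto (fun k => d (N (φ k) a)) atTop (𝓝 (g a)) := by
  obtain ⟨f, hf, hfs⟩ := exists_nat_bool_continuous_surjective_of_compact X
  let q : cantorSet → X := fun x => f (cantorSetHomeomorphNatToBool x)
  have hq : Continuous q := hf.comp cantorSetHomeomorphNatToBool.continuous
  have hqs : Function.Surjective q := hfs.comp cantorSetHomeomorphNatToBool.surjective
  choose s hs using fun k => hqs (d k)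
  let x : ℕ → α → ℝ := fun n a => (s (N n a) : ℝ)
  have hx : ∀ n, Measurable (x n) := fun n =>
    (measurable_from_nat (f := fun k => (s k : ℝ))).comp (hN n)
  have hxI : ∀ n a, x n a ∈ Set.Icc (0 : ℝ) 1 := fun n a =>
    cantorSet_subset_unitInterval (s (N n a)).2
  have hseq : ∀ a, ∃ φ : ℕ → ℕ,
      Tendsto ((fun n => x n a) ∘ φ) atTop (𝓝 (liminf (fun n => x n a) atTop)) ∧
        Tendsto φ atTop atTop := fun a =>
    exists_seq_tendsto_liminf
      (IsBoundedUnder.isCoboundedUnder_ge ⟨1, by simpa using ⟨0, fun n _ => (hxI n a).2⟩⟩)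
      ⟨0, by simpa using ⟨0, fun n _ => (hxI n a).1⟩⟩
  have hL : ∀ a, liminf (fun n => x n a) atTop ∈ cantorSet := fun a => by
    obtain ⟨φ, hφ, -⟩ := hseq a
    exact isClosed_cantorSet.mem_of_tendsto hφ (.of_forall fun k => (s (N (φ k) a)).2)
  refine ⟨fun a => q ⟨liminf (fun n => x n a) atTop, hL a⟩,
    hq.measurable.comp ((Measurable.liminf hx).subtype_mk), fun a => ?_⟩
  obtain ⟨φ, hφ, hφ'⟩ := hseq a
  refine ⟨φ, hφ', ?_⟩
  have h : Tendsto (fun k => s (N (φ k) a)) atTop (𝓝 ⟨_, hL a⟩) := tendsto_subtype_rng.2 hφ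
  simpa only [Function.comp_def, hs] using (hq.tendsto _).comp h

/-- Measurable selection of an approximate minimizer over a sequence: at every parameter where the
integrand is sequentially lower semicontinuous, the selection does at least as well as the
infimum over the sequence. -/
theorem exists_measurable_le_iInf {α X : Type*} [MeasurableSpace α] [MetricSpace X]
    [CompactSpace X] [Nonempty X] [MeasurableSpace X] [BorelSpace X] (d : ℕ → X)
    (F : α → X → ℝ≥0∞) (hF : ∀ k, Measurable fun a => F a (d k)) :
    ∃ g : α → X, Measurable g ∧ ∀ a,
      (∀ (x : ℕ → X) (y : X), Tendsto x atTop (𝓝 y) → F a y ≤ liminf (fun k => F a (x k)) atTop) →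
        F a (g a) ≤ ⨅ k, F a (d k) := by
  classical
  let V : α → ℝ≥0∞ := fun a => ⨅ k, F a (d k)
  have hV : Measurable V := .iInf hF
  let ε : ℕ → ℝ≥0∞ := fun n => ((n : ℝ≥0∞) + 1)⁻¹
  have hε : ∀ n, ε n ≠ 0 := fun n => by simp [ε]
  have hε0 : Tendsto ε atTop (𝓝 0) := by
    simpa [ε, Function.comp_def] using
      ENNReal.tendsto_inv_nat_nhds_zero.comp (tendsto_add_atTop_nat 1)
  have hex : ∀ n a, ∃ k, F a (d k) ≤ V a + ε n := fun n a => by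
    by_cases h : V a = ⊤
    · exact ⟨0, by simp [h]⟩
    · obtain ⟨k, hk⟩ := iInf_lt_iff.1 (ENNReal.lt_add_right h (hε n))
      exact ⟨k, hk.le⟩
  obtain ⟨g, hg, hlim⟩ := exists_measurable_subseq_limit d (fun n a => Nat.find (hex n a))
    fun n => measurable_find (hex n) fun k => measurableSet_le (hF k) (hV.add_const _)
  refine ⟨g, hg, fun a ha => ?_⟩
  obtain ⟨φ, hφ, hφg⟩ := hlim a
  have ht : Tendsto (fun k => V a + ε (φ k)) atTop (𝓝 (V a)) := by
    simpa using (tendsto_const_nhds (x := V a)).add (hε0.comp hφ)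
  calc F a (g a) ≤ liminf (fun k => F a (d (Nat.find (hex (φ k) a)))) atTop := ha _ _ hφg
    _ ≤ liminf (fun k => V a + ε (φ k)) atTop :=
        liminf_le_liminf (.of_forall fun k => Nat.find_spec (hex (φ k) a))
    _ = V a := ht.liminf_eq

/-- Disintegration of the joint law of `(ω, U ω)` along a regular conditional distribution. -/
theorem IsRCD.lintegral_eq {Ω : Type*} {inst : MeasurableSpace Ω} {P : Measure Ω}
    [IsProbabilityMeasure P] {m : ℕ} {U : Ω → (Fin m → ℝ)} (hUmeas : Measurable U)
    {G : MeasurableSpace Ω} (hG : G ≤ inst) {κ : Ω → Measure (Fin m → ℝ)}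
    (hκ : @IsRCD Ω inst m P G U κ) {f : Ω × (Fin m → ℝ) → ℝ≥0∞}
    (hf : Measurable[G.prod MeasurableSpace.pi] f) :
    ∫⁻ ω, f (ω, U ω) ∂P = ∫⁻ ω, ∫⁻ u, f (ω, u) ∂κ ω ∂P := by
  obtain ⟨hprob, hmeas, hint⟩ := hκ
  let K : @Kernel Ω (Fin m → ℝ) G MeasurableSpace.pi :=
    @Kernel.mk _ _ G _ κ (@Measure.measurable_of_measurable_coe _ _ _ G _ hmeas)
  have hK : @IsMarkovKernel _ _ G _ K := @IsMarkovKernel.mk _ _ G _ K hprob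
  have hpair : @Measurable _ _ inst (G.prod MeasurableSpace.pi) fun ω => (ω, U ω) :=
    @Measurable.prodMk _ inst _ _ G _ _ _ (measurable_id.mono le_rfl hG) hUmeas
  have hjoint : @Measure.compProd _ _ G _ (P.trim hG) K =
      @Measure.map _ _ inst (G.prod MeasurableSpace.pi) (fun ω => (ω, U ω)) P := by
    refine @Measure.ext_prod _ _ G _ _ _ (by infer_instance) fun {s t} hs ht => ?_
    rw [Measure.compProd_apply_prod hs ht,
      Measure.map_apply hpair (@MeasurableSet.prod _ _ G _ _ _ hs ht),
      restrict_trim hG P hs, lintegral_trim hG (f := fun ω => K ω t) (hmeas t ht)]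
    exact hint t ht s hs
  rw [← @lintegral_map _ _ inst (G.prod MeasurableSpace.pi) P f _ hf hpair, ← hjoint,
    Measure.lintegral_compProd hf,
    lintegral_trim hG (@Measurable.lintegral_kernel_prod_right' _ _ G _ K _ f hf)]
  rfl

theorem measurableSet_Uset (m : ℕ) : MeasurableSet (Uset m) := by
  have h1 : Measurable fun u : Fin m → ℝ => ip (bhat m) u := by unfold ip; fun_prop
  have h2 : Uset m = (⋂ i, {u | 0 < u i}) ∩ {u | ip (bhat m) u = 1} := by
    ext u; simp [Uset]
  rw [h2]
  exact (MeasurableSet.iInter fun i =>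
    measurableSet_lt measurable_const (measurable_pi_apply i)).inter (h1 (measurableSet_singleton 1))

/-- A regular conditional distribution of a `Uset`-valued map is carried by `Uset`. -/
theorem IsRCD.ae_mem_Uset {Ω : Type*} {inst : MeasurableSpace Ω} {P : Measure Ω}
    {m : ℕ} {U : Ω → (Fin m → ℝ)} (hU : ∀ ω, U ω ∈ Uset m)
    {G : MeasurableSpace Ω} (hG : G ≤ inst) {κ : Ω → Measure (Fin m → ℝ)}
    (hκ : @IsRCD Ω inst m P G U κ) : ∀ᵐ ω ∂P, ∀ᵐ u ∂κ ω, u ∈ Uset m := by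
  have h := hκ.2.2 _ (measurableSet_Uset m).compl Set.univ MeasurableSet.univ
  have hempty : U ⁻¹' (Uset m)ᶜ = ∅ := by ext ω; simp [hU ω]
  rw [hempty, Set.inter_empty, measure_empty, Measure.restrict_univ,
    lintegral_eq_zero_iff ((hκ.2.1 _ (measurableSet_Uset m).compl).mono hG le_rfl)] at h
  filter_upwards [h] with ω hω
  exact hω

theorem measurable_nlog (m : ℕ) : Measurable (nlog m) :=
  Measurable.ite measurableSet_Iic measurable_const
    (measurable_const.sub Real.measurable_log).ennreal_ofReal

theorem measurable_ip {α : Type*} [MeasurableSpace α] {m : ℕ} {f g : α → Fin m → ℝ}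
    (hf : Measurable f) (hg : Measurable g) : Measurable fun a => ip (f a) (g a) := by
  unfold ip; fun_prop

theorem nlog_antitone (m : ℕ) : Antitone (nlog m) := by
  intro r s hrs
  unfold nlog
  by_cases hr : r ≤ 0
  · simp [hr]
  · rw [if_neg hr, if_neg (by linarith)]
    gcongr
    exact not_le.1 hr

theorem nlog_mul_le (m : ℕ) {c : ℝ} (hc : 0 < c) (r : ℝ) :
    nlog m (c * r) ≤ nlog m r + ENNReal.ofReal (-Real.log c) := by
  unfold nlog
  by_cases hr : r ≤ 0
  · simp [hr]
  · have hr' := not_le.1 hr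
    rw [if_neg hr, if_neg (not_le.2 (mul_pos hc hr')), Real.log_mul hc.ne' hr'.ne']
    refine le_trans (le_of_eq ?_) ENNReal.ofReal_add_le
    ring_nf

theorem continuousAt_nlog (m : ℕ) {r : ℝ} (hr : 0 < r) : ContinuousAt (nlog m) r := by
  have h : (fun r => ENNReal.ofReal (Real.log m - Real.log r)) =ᶠ[𝓝 r] nlog m := by
    filter_upwards [lt_mem_nhds hr] with s hs
    simp [nlog, not_le.2 hs]
  refine ContinuousAt.congr ?_ h
  exact ENNReal.continuous_ofReal.continuousAt.comp
    (continuousAt_const.sub (Real.continuousAt_log hr.ne'))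

theorem ip_pos {m : ℕ} {b u : Fin m → ℝ} (hb : b ∈ simplex m) (hu : u ∈ Uset m) :
    0 < ip b u := by
  refine Finset.sum_pos' (fun i _ => mul_nonneg (hb.1 i) (hu.1 i).le) ?_
  by_contra! h
  have h0 : ∀ i, b i = 0 := fun i => le_antisymm
    (by have := h i (Finset.mem_univ i); have := hu.1 i; nlinarith) (hb.1 i)
  have := hb.2
  simp [h0] at this

theorem bhat_mem_simplex {m : ℕ} (hm : m ≠ 0) : bhat m ∈ simplex m :=
  ⟨fun _ => by simp [bhat], by simp [bhat, hm]⟩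

/-- Sequential lower semicontinuity of `b ↦ ∫ (log m - log⟨b, u⟩) dQ(u)` on the simplex. -/
theorem lintegral_nlog_le_liminf {m : ℕ} {Q : Measure (Fin m → ℝ)}
    (hQ : ∀ᵐ u ∂Q, u ∈ Uset m) {x : ℕ → Fin m → ℝ} {y : Fin m → ℝ} (hy : y ∈ simplex m)
    (hxy : Tendsto x atTop (𝓝 y)) :
    ∫⁻ u, nlog m (ip y u) ∂Q ≤ liminf (fun k => ∫⁻ u, nlog m (ip (x k) u) ∂Q) atTop := by
  refine le_trans (lintegral_mono_ae ?_) (lintegral_liminf_le fun k =>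
    (measurable_nlog m).comp (measurable_ip measurable_const measurable_id))
  filter_upwards [hQ] with u hu
  have hc : Continuous fun b : Fin m → ℝ => ip b u := by unfold ip; fun_prop
  exact (((continuousAt_nlog m (ip_pos hy hu)).tendsto.comp
    ((hc.tendsto y).comp hxy)).liminf_eq).ge

/-- The infimum of the expected negative log-return over a dense sequence of portfolios is the
infimum over the whole simplex. -/
theorem iInf_lintegral_nlog_le {m : ℕ} (hm : m ≠ 0) {Q : Measure (Fin m → ℝ)}
    [IsProbabilityMeasure Q] (hQ : ∀ᵐ u ∂Q, u ∈ Uset m) {d : ℕ → simplex m} (hd : DenseRange d)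
    {b : Fin m → ℝ} (hb : b ∈ simplex m) :
    ⨅ k, ∫⁻ u, nlog m (ip (d k) u) ∂Q ≤ ∫⁻ u, nlog m (ip b u) ∂Q := by
  have hm' : (0 : ℝ) < m := by positivity
  have key : ∀ c ∈ Set.Ioo (0 : ℝ) 1, ⨅ k, ∫⁻ u, nlog m (ip (d k) u) ∂Q ≤
      ∫⁻ u, nlog m (ip b u) ∂Q + ENNReal.ofReal (-Real.log c) := by
    rintro c ⟨hc0, hc1⟩
    let b' : simplex m := ⟨fun i => c * b i + (1 - c) * (m : ℝ)⁻¹,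
      fun i => add_nonneg (mul_nonneg hc0.le (hb.1 i)) (mul_nonneg (by linarith) (by positivity)),
      by simp [Finset.sum_add_distrib, ← Finset.mul_sum, hb.2]
         field_simp
         ring⟩
    have hpos : 0 < (1 - c) * (m : ℝ)⁻¹ := mul_pos (by linarith) (by positivity)
    obtain ⟨k, hk⟩ := hd.exists_dist_lt b' hpos
    refine (iInf_le _ k).trans ?_
    have hle : ∀ i, c * b i ≤ (d k : Fin m → ℝ) i := fun i => by
      have h1 : dist ((b' : Fin m → ℝ) i) ((d k : Fin m → ℝ) i) < (1 - c) * (m : ℝ)⁻¹ :=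
        (dist_le_pi_dist _ _ i).trans_lt hk
      rw [Real.dist_eq] at h1
      have h2 := (abs_lt.1 h1).2
      simp only [b'] at h2
      linarith
    calc ∫⁻ u, nlog m (ip (d k) u) ∂Q
        ≤ ∫⁻ u, (nlog m (ip b u) + ENNReal.ofReal (-Real.log c)) ∂Q := by
          refine lintegral_mono_ae ?_
          filter_upwards [hQ] with u hu
          refine (nlog_antitone m ?_).trans (nlog_mul_le m hc0 _)
          unfold ip
          rw [Finset.mul_sum]
          refine Finset.sum_le_sum fun i _ => ?_
          rw [← mul_assoc]
          exact mul_le_mul_of_nonneg_right (hle i) (hu.1 i).le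
      _ = _ := by
          rw [lintegral_add_right _ measurable_const]
          simp
  have hlim : Tendsto (fun c : ℝ => ∫⁻ u, nlog m (ip b u) ∂Q + ENNReal.ofReal (-Real.log c))
      (𝓝[<] 1) (𝓝 (∫⁻ u, nlog m (ip b u) ∂Q)) := by
    have h1 : Tendsto (fun c : ℝ => ENNReal.ofReal (-Real.log c)) (𝓝 1) (𝓝 0) := by
      have := (ENNReal.continuous_ofReal.tendsto _).comp
        (Real.continuousAt_log one_ne_zero).neg.tendsto
      simpa [Function.comp_def] using this
    simpa using (tendsto_const_nhds (x := ∫⁻ u, nlog m (ip b u) ∂Q)).add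
      (h1.mono_left nhdsWithin_le_nhds)
  exact ge_of_tendsto hlim (by
    filter_upwards [Ioo_mem_nhdsLT (zero_lt_one' ℝ)] with c hc using key c hc)

theorem lintegral_nlog_bhat {m : ℕ} {Q : Measure (Fin m → ℝ)} [IsProbabilityMeasure Q]
    (hQ : ∀ᵐ u ∂Q, u ∈ Uset m) :
    ∫⁻ u, nlog m (ip (bhat m) u) ∂Q = ENNReal.ofReal (Real.log m) := by
  rw [lintegral_congr_ae (g := fun _ => ENNReal.ofReal (Real.log m))]
  · simp
  · filter_upwards [hQ] with u hu
    simp [hu.2, nlog]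

theorem IsRCD.measurable_lintegral {Ω : Type*} {inst : MeasurableSpace Ω} {P : Measure Ω} {m : ℕ}
    {U : Ω → (Fin m → ℝ)} {G : MeasurableSpace Ω} {κ : Ω → Measure (Fin m → ℝ)}
    (hκ : @IsRCD Ω inst m P G U κ) {h : Ω → (Fin m → ℝ)} (hh : Measurable[G] h) :
    Measurable[G] fun ω => ∫⁻ u, nlog m (ip (h ω) u) ∂κ ω := by
  let K : @Kernel Ω (Fin m → ℝ) G MeasurableSpace.pi :=
    @Kernel.mk _ _ G _ κ (@Measure.measurable_of_measurable_coe _ _ _ G _ hκ.2.1)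
  have hK : @IsMarkovKernel _ _ G _ K := @IsMarkovKernel.mk _ _ G _ K hκ.1
  exact @Measurable.lintegral_kernel_prod_right' _ _ G _ K _ _ ((measurable_nlog m).comp
    (@measurable_ip _ (G.prod MeasurableSpace.pi) m _ _
      (hh.comp (@measurable_fst _ _ G _)) (@measurable_snd _ _ G _)))

/-- The expected log-return of an adapted portfolio is the mean of its conditional value. -/
theorem IsRCD.elogE_eq {Ω : Type*} {inst : MeasurableSpace Ω} {P : Measure Ω}
    [IsProbabilityMeasure P] {m : ℕ} {U : Ω → (Fin m → ℝ)} (hUmeas : Measurable U)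
    {G : MeasurableSpace Ω} (hG : G ≤ inst) {κ : Ω → Measure (Fin m → ℝ)}
    (hκ : @IsRCD Ω inst m P G U κ) {h : Ω → (Fin m → ℝ)} (hh : Measurable[G] h) :
    @elogE Ω inst P m h U = (Real.log m : EReal) -
      ((∫⁻ ω, ∫⁻ u, nlog m (ip (h ω) u) ∂κ ω ∂P : ℝ≥0∞) : EReal) := by
  have hf : Measurable[G.prod MeasurableSpace.pi]
      fun p : Ω × (Fin m → ℝ) => nlog m (ip (h p.1) p.2) :=
    (measurable_nlog m).comp (@measurable_ip _ (G.prod MeasurableSpace.pi) m _ _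
      (hh.comp (@measurable_fst _ _ G _)) (@measurable_snd _ _ G _))
  rw [← hκ.lintegral_eq hUmeas hG hf]
  rfl

/-- A `G`-measurable portfolio minimizing the conditional expected negative log-return. -/
theorem IsRCD.exists_measurable_minimizer {Ω : Type*} {inst : MeasurableSpace Ω} {P : Measure Ω}
    {m : ℕ} (hm : m ≠ 0) {U : Ω → (Fin m → ℝ)} (hU : ∀ ω, U ω ∈ Uset m)
    {G : MeasurableSpace Ω} (hG : G ≤ inst) {κ : Ω → Measure (Fin m → ℝ)}
    (hκ : @IsRCD Ω inst m P G U κ) :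
    ∃ g : Ω → (Fin m → ℝ), Measurable[G] g ∧ (∀ ω, g ω ∈ simplex m) ∧
      ∀ᵐ ω ∂P, ∀ b ∈ simplex m,
        ∫⁻ u, nlog m (ip (g ω) u) ∂κ ω ≤ ∫⁻ u, nlog m (ip b u) ∂κ ω := by
  have : Nonempty (simplex m) := ⟨⟨bhat m, bhat_mem_simplex hm⟩⟩
  have : CompactSpace (simplex m) :=
    isCompact_iff_compactSpace.1 (isCompact_stdSimplex ℝ (Fin m))
  let d := TopologicalSpace.denseSeq (simplex m)
  obtain ⟨g, hg, hmin⟩ := @exists_measurable_le_iInf Ω (simplex m) G _ _ _ _ _ d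
    (fun ω b => ∫⁻ u, nlog m (ip b u) ∂κ ω)
    (fun k => hκ.measurable_lintegral (h := fun _ => d k) (@measurable_const _ _ _ G _))
  refine ⟨fun ω => g ω, measurable_subtype_coe.comp hg, fun ω => (g ω).2, ?_⟩
  filter_upwards [hκ.ae_mem_Uset hU hG] with ω hω b hb
  have := hκ.1 ω
  exact (hmin ω fun x y hxy => lintegral_nlog_le_liminf hω y.2
    ((continuous_subtype_val.tendsto y).comp hxy)).trans
      (iInf_lintegral_nlog_le hm hω (TopologicalSpace.denseRange_denseSeq _) hb)

/-- Lemma 3(a): (i) there is a `𝒢`-measurable portfolio attaining, almost everywhere, the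
conditionally optimal expected log-return; (ii) the expectation of the conditional optimum
equals the supremum of `E(log⟨h, U⟩)` over `𝒢`-measurable random portfolios `h`. -/
theorem stmt_4 {Ω : Type*} [inst : MeasurableSpace Ω] [StandardBorelSpace Ω]
    (P : Measure Ω) [IsProbabilityMeasure P] (m : ℕ) (hm : 2 ≤ m)
    (U : Ω → (Fin m → ℝ)) (hUmeas : Measurable U) (hU : ∀ ω, U ω ∈ Uset m)
    (G : MeasurableSpace Ω) (hG : G ≤ inst)
    (κ : Ω → Measure (Fin m → ℝ)) (hκ : @IsRCD Ω inst m P G U κ) :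
    (∃ g : Ω → (Fin m → ℝ), Measurable[G] g ∧ (∀ ω, g ω ∈ simplex m) ∧
      ∀ᵐ ω ∂P, elogQ (κ ω) (g ω) = ⨆ b ∈ simplex m, elogQ (κ ω) b) ∧
    ((∫ ω, (⨆ b ∈ simplex m, elogQ (κ ω) b).toReal ∂P : ℝ) : EReal)
      = ⨆ h ∈ {h : Ω → (Fin m → ℝ) | Measurable[G] h ∧ ∀ ω, h ω ∈ simplex m},
          @elogE Ω inst P m h U := by
  obtain ⟨g, hg, hgs, hmin⟩ := hκ.exists_measurable_minimizer (by omega) hU hG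
  have hopt : ∀ᵐ ω ∂P, elogQ (κ ω) (g ω) = ⨆ b ∈ simplex m, elogQ (κ ω) b := by
    filter_upwards [hmin] with ω hω
    refine le_antisymm (le_iSup₂_of_le (g ω) (hgs ω) le_rfl) (iSup₂_le fun b hb => ?_)
    exact EReal.sub_le_sub le_rfl (EReal.coe_ennreal_le_coe_ennreal_iff.2 (hω b hb))
  refine ⟨⟨g, hg, hgs, hopt⟩, ?_⟩
  set F : Ω → ℝ≥0∞ := fun ω => ∫⁻ u, nlog m (ip (g ω) u) ∂κ ω
  have hFmeas : Measurable[inst] F := (hκ.measurable_lintegral hg).mono hG le_rfl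
  have hFle : ∀ᵐ ω ∂P, F ω ≤ ENNReal.ofReal (Real.log m) := by
    filter_upwards [hmin, hκ.ae_mem_Uset hU hG] with ω hω hωU
    have := hκ.1 ω
    exact (hω _ (bhat_mem_simplex (by omega))).trans (lintegral_nlog_bhat hωU).le
  have hFtop : ∀ᵐ ω ∂P, F ω < ∞ := hFle.mono fun ω hω => hω.trans_lt ENNReal.ofReal_lt_top
  have hI : ∫⁻ ω, F ω ∂P ≠ ∞ := by
    refine ((lintegral_mono_ae hFle).trans_lt ?_).ne
    simp
  have hsup : (⨆ h ∈ {h : Ω → (Fin m → ℝ) | Measurable[G] h ∧ ∀ ω, h ω ∈ simplex m},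
      @elogE Ω inst P m h U) = (Real.log m : EReal) - ((∫⁻ ω, F ω ∂P : ℝ≥0∞) : EReal) := by
    refine le_antisymm (iSup₂_le fun h hh => ?_)
      (le_iSup₂_of_le g ⟨hg, hgs⟩ (hκ.elogE_eq hUmeas hG hg).ge)
    rw [hκ.elogE_eq hUmeas hG hh.1]
    refine EReal.sub_le_sub le_rfl (EReal.coe_ennreal_le_coe_ennreal_iff.2 ?_)
    exact lintegral_mono_ae (hmin.mono fun ω hω => hω _ (hh.2 ω))
  have hint : ∫ ω, (⨆ b ∈ simplex m, elogQ (κ ω) b).toReal ∂P =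
      Real.log m - (∫⁻ ω, F ω ∂P).toReal := by
    have hae : ∀ᵐ ω ∂P, (⨆ b ∈ simplex m, elogQ (κ ω) b).toReal =
        Real.log m - (F ω).toReal := by
      filter_upwards [hopt, hFtop] with ω hω hωtop
      rw [← hω, elogQ, ← EReal.coe_toReal (x := ((F ω : ℝ≥0∞) : EReal)) (by simpa using hωtop.ne)
        (EReal.coe_ennreal_ne_bot _), ← EReal.coe_sub, EReal.toReal_coe,
        EReal.toReal_coe_ennreal]
    rw [integral_congr_ae hae, integral_sub (integrable_const _)
      (integrable_toReal_of_lintegral_ne_top hFmeas.aemeasurable hI),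
      integral_toReal hFmeas.aemeasurable hFtop]
    simp
  rw [hsup, hint, EReal.coe_sub, EReal.coe_ennreal_toReal hI]
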